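/- Let Γ be a labelled graph with vertex set V, let A_Γ be its Artin group, and let T ⊆ V be the set of cone points of Γ. Then the center Z(A_Γ) is contained in the special subgroup A_T; in particular every central element of A_Γ lies in (and is central in) A_T. -/

import Mathlib

/-- A labelled graph: a vertex set `V` and a symmetric labelling `m : V → V → ℕ∞`
with `m u v ≥ 2` for `u ≠ v` (`m u v = ∞` means no edge). -/
structure LabelledGraph (V : Type*) where
  m : V → V → ℕ∞
  symm : ∀ u v, m u v = m v u
  two_le : ∀ u v, u ≠ v → 2 ≤ m u v

namespace LabelledGraph

variable {V W : Type*}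

/-- The alternating product `x * y * x * ⋯` with `n` terms. -/
def altProd {G : Type*} [Monoid G] (x y : G) : ℕ → G
  | 0 => 1
  | n + 1 => x * altProd y x n

/-- The alternating word `u v u v ⋯` with `n` terms in the free group. -/
def altWord (u v : V) (n : ℕ) : FreeGroup V :=
  altProd (FreeGroup.of u) (FreeGroup.of v) n

/-- The Artin relations of a labelled graph: for each `u ≠ v` with finite label
`m u v = k`, the relation `(u v u ⋯) = (v u v ⋯)` (both sides with `k` terms). -/
def artinRels (Γ : LabelledGraph V) : Set (FreeGroup V) :=
  { r | ∃ (u v : V) (k : ℕ), u ≠ v ∧ Γ.m u v = (k : ℕ∞) ∧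
        r = altWord u v k * (altWord v u k)⁻¹ }

/-- The Artin group of a labelled graph. -/
abbrev ArtinGroup (Γ : LabelledGraph V) : Type _ := PresentedGroup Γ.artinRels

/-- The standard generators of an Artin group. -/
def σ (Γ : LabelledGraph V) (v : V) : Γ.ArtinGroup := PresentedGroup.of v

/-- The special subgroup of the Artin group generated by `{σ v : v ∈ K}`. -/
def specialSubgroup (Γ : LabelledGraph V) (K : Set V) : Subgroup Γ.ArtinGroup :=
  Subgroup.closure (Γ.σ '' K)

/-- A cone point of `Γ`: a vertex `t` with `m t v < ∞` for every `v ≠ t`. -/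
def IsConePoint (Γ : LabelledGraph V) (t : V) : Prop :=
  ∀ v : V, v ≠ t → Γ.m t v ≠ ⊤

/-- The induced labelled subgraph on a subset `K` of the vertices. -/
def induce (Γ : LabelledGraph V) (K : Set V) : LabelledGraph K where
  m u v := Γ.m u v
  symm u v := Γ.symm u v
  two_le u v h := Γ.two_le u v (fun e => h (Subtype.ext e))

/-- `Γ` is irreducible if its vertex set admits no partition into two nonempty sets
with all labels between the two parts equal to `2`. -/
def Irreducible (Γ : LabelledGraph V) : Prop :=
  ¬ ∃ V₁ V₂ : Set V, V₁.Nonempty ∧ V₂.Nonempty ∧ Disjoint V₁ V₂ ∧ V₁ ∪ V₂ = Set.univ ∧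
      ∀ u ∈ V₁, ∀ v ∈ V₂, Γ.m u v = 2

/-- The square relations `σ_v² = 1` defining the Coxeter quotient. -/
def squareRels (V : Type*) : Set (FreeGroup V) :=
  Set.range fun v : V => FreeGroup.of v * FreeGroup.of v

/-- The Coxeter group of a labelled graph: the quotient of the Artin group obtained
by adding the relations `σ_v² = 1`. -/
abbrev CoxeterGroupOf (Γ : LabelledGraph V) : Type _ :=
  PresentedGroup (Γ.artinRels ∪ squareRels V)

/-- `Γ` is spherical if its Coxeter group is finite. -/
def Spherical (Γ : LabelledGraph V) : Prop := Finite Γ.CoxeterGroupOf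

/-- The natural surjection `θ` from the Artin group to the Coxeter group. -/
def artinToCoxeter (Γ : LabelledGraph V) : Γ.ArtinGroup →* Γ.CoxeterGroupOf :=
  QuotientGroup.map _ _ (MonoidHom.id _)
    (by
      intro x hx
      simpa using Subgroup.normalClosure_mono (Set.subset_union_left (t := squareRels V)) hx)

/-- The pure Artin group: the kernel of the natural surjection to the Coxeter group. -/
def pureArtinGroup (Γ : LabelledGraph V) : Subgroup Γ.ArtinGroup :=
  (artinToCoxeter Γ).ker

/-- `P : Fin n → Set V` is a decomposition of `Γ` as a `2`-labelled join of
irreducible induced subgraphs. -/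
def IsIrredDecomp (Γ : LabelledGraph V) (n : ℕ) (P : Fin n → Set V) : Prop :=
  (∀ i, (P i).Nonempty) ∧
  (⋃ i, P i) = Set.univ ∧
  (∀ i j, i ≠ j → Disjoint (P i) (P j)) ∧
  (∀ i j, i ≠ j → ∀ u ∈ P i, ∀ v ∈ P j, Γ.m u v = 2) ∧
  (∀ i, (Γ.induce (P i)).Irreducible)

/-- `Γ` satisfies the Center Conjecture if for the (finest) decomposition of `Γ` as a
`2`-labelled join of irreducible induced subgraphs `Γ₁, …, Γₙ`, the center of the Artin
group `A_Γ` is free abelian of rank the number of spherical factors `Γᵢ`. -/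
def SatisfiesCenterConjecture (Γ : LabelledGraph V) : Prop :=
  ∀ (n : ℕ) (P : Fin n → Set V), Γ.IsIrredDecomp n P →
    Nonempty ((Subgroup.center Γ.ArtinGroup) ≃*
      Multiplicative (Fin (Nat.card {i : Fin n // (Γ.induce (P i)).Spherical}) → ℤ))

/-- A monoid hom applied to an alternating product. -/
theorem map_altProd {G H : Type*} [Monoid G] [Monoid H] (φ : G →* H) (x y : G) (n : ℕ) :
    φ (altProd x y n) = altProd (φ x) (φ y) n := by
  induction n generalizing x y with
  | zero => simp [altProd]
  | succ n ih => simp [altProd, ih]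

/-- The homomorphism between Artin groups induced by a label-preserving injection of
labelled graphs, sending generators to generators. -/
def mapHom (Γ : LabelledGraph V) (Δ : LabelledGraph W) (f : V → W)
    (hf : ∀ u v : V, u ≠ v → f u ≠ f v)
    (hm : ∀ u v : V, Γ.m u v = Δ.m (f u) (f v)) :
    Γ.ArtinGroup →* Δ.ArtinGroup :=
  PresentedGroup.toGroup (f := fun v => Δ.σ (f v))
    (by
      rintro r ⟨u, v, k, huv, hk, rfl⟩
      have key : ∀ (a b : V),
          FreeGroup.lift (fun v => Δ.σ (f v)) (altWord a b k)
            = PresentedGroup.mk Δ.artinRels (altWord (f a) (f b) k) := by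
        intro a b
        rw [altWord, map_altProd, altWord, map_altProd]
        simp [σ, PresentedGroup.of]
      rw [map_mul, map_inv, key, key, ← map_inv, ← map_mul]
      refine (QuotientGroup.eq_one_iff _).mpr (Subgroup.subset_normalClosure ?_)
      exact ⟨f u, f v, k, hf u v huv, (hm u v) ▸ hk, rfl⟩)

@[simp]
theorem mapHom_σ (Γ : LabelledGraph V) (Δ : LabelledGraph W) (f : V → W)
    (hf : ∀ u v : V, u ≠ v → f u ≠ f v)
    (hm : ∀ u v : V, Γ.m u v = Δ.m (f u) (f v)) (v : V) :
    mapHom Γ Δ f hf hm (Γ.σ v) = Δ.σ (f v) :=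
  PresentedGroup.toGroup.of _

/-- The homomorphism between the Artin groups of induced subgraphs coming from an
inclusion `K' ⊆ K`. -/
def induceHom (Γ : LabelledGraph V) {K' K : Set V} (h : K' ⊆ K) :
    (Γ.induce K').ArtinGroup →* (Γ.induce K).ArtinGroup :=
  mapHom _ _ (Set.inclusion h)
    (fun _ _ huv e => huv (Set.inclusion_injective h e))
    (fun _ _ => rfl)

/-- The homomorphism from the Artin group of an induced subgraph to the ambient
Artin group. -/
def inclHom (Γ : LabelledGraph V) (K : Set V) :
    (Γ.induce K).ArtinGroup →* Γ.ArtinGroup :=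
  mapHom _ _ Subtype.val
    (fun _ _ huv e => huv (Subtype.ext e))
    (fun _ _ => rfl)

end LabelledGraph

namespace LabelledGraph

section AlternatingProducts

variable {G : Type*} [Group G]

theorem altProd_mul_inv_altProd {a b : G} (ha : a * a = 1) (hb : b * b = 1) (n : ℕ) :
    altProd a b n * (altProd b a n)⁻¹ = (a * b) ^ n := by
  induction n generalizing a b with
  | zero => simp [altProd]
  | succ n ih =>
    have hb' : b⁻¹ = b := inv_eq_of_mul_eq_one_left hb
    calc altProd a b (n + 1) * (altProd b a (n + 1))⁻¹
        = a * (altProd b a n * (altProd a b n)⁻¹) * b⁻¹ := by simp [altProd, mul_assoc]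
      _ = (a * b) ^ (n + 1) := by rw [ih hb ha, hb', ← mul_pow_mul, mul_assoc, ← pow_succ]

theorem altProd_comm_iff {a b : G} (ha : a * a = 1) (hb : b * b = 1) (n : ℕ) :
    altProd a b n = altProd b a n ↔ (a * b) ^ n = 1 := by
  rw [← altProd_mul_inv_altProd ha hb, mul_inv_eq_one]

/-- The alternating product `⋯ * x * y * x` with `n` terms, built from the right. -/
def altProdRight {M : Type*} [Monoid M] (x y : M) : ℕ → M
  | 0 => 1
  | n + 1 => altProdRight y x n * x

theorem altProdRight_succ' {M : Type*} [Monoid M] (x y : M) (n : ℕ) :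
    altProdRight x y (n + 1) = (if Even n then x else y) * altProdRight x y n := by
  induction n generalizing x y with
  | zero => simp [altProdRight]
  | succ n ih =>
    calc altProdRight x y (n + 1 + 1) = altProdRight y x (n + 1) * x := rfl
      _ = (if Even n then y else x) * altProdRight x y (n + 1) := by rw [ih, mul_assoc]; rfl
      _ = _ := by simp only [Nat.even_add_one, ite_not]

theorem altProd_eq_altProdRight {M : Type*} [Monoid M] (x y : M) (n : ℕ) :
    altProd x y n = if Even n then altProdRight y x n else altProdRight x y n := by
  induction n generalizing x y with
  | zero => simp [altProd, altProdRight]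
  | succ n ih =>
    rw [altProd, ih, altProdRight_succ', altProdRight_succ']
    simp only [Nat.even_add_one]
    split_ifs <;> simp_all

theorem altProdRight_comm_iff {M : Type*} [Monoid M] (x y : M) (n : ℕ) :
    altProdRight x y n = altProdRight y x n ↔ altProd x y n = altProd y x n := by
  rw [altProd_eq_altProdRight, altProd_eq_altProdRight]
  split_ifs
  exacts [eq_comm, Iff.rfl]

open Classical in
/-- The number of times `g` occurs among the first `n` palindromes `a`, `a b a`, `a b a b a`, …. -/
noncomputable def palindromeCount (a b : G) (n : ℕ) (g : G) : ℕ :=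
  ∑ j ∈ Finset.range n, if (a * b) ^ j * a = g then 1 else 0

open Classical in
theorem palindromeCount_succ {a : G} (ha : a * a = 1) (b : G) (n : ℕ) (g : G) :
    palindromeCount a b (n + 1) g =
      palindromeCount b a n (a * g * a) + if g = a then 1 else 0 := by
  have ha' : a⁻¹ = a := inv_eq_of_mul_eq_one_left ha
  rw [palindromeCount, Finset.sum_range_succ', palindromeCount]
  congr 1
  · refine Finset.sum_congr rfl fun j _ => if_congr ?_ rfl rfl
    have key : (a * b) ^ (j + 1) * a = a⁻¹ * ((b * a) ^ j * b) * a⁻¹ := by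
      rw [ha', mul_pow_mul, pow_succ]
      simp only [mul_assoc]
    rw [key, mul_inv_eq_iff_eq_mul, inv_mul_eq_iff_eq_mul, mul_assoc]
  · simp [eq_comm]

theorem palindromeCount_comm {a b : G} (ha : a * a = 1) (hb : b * b = 1) {n : ℕ}
    (h : (a * b) ^ n = 1) (g : G) : palindromeCount a b n g = palindromeCount b a n g := by
  classical
  have ha' : a⁻¹ = a := inv_eq_of_mul_eq_one_left ha
  have hb' : b⁻¹ = b := inv_eq_of_mul_eq_one_left hb
  rw [palindromeCount, ← Finset.sum_range_reflect, palindromeCount]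
  refine Finset.sum_congr rfl fun j hj => if_congr (Eq.congr_left ?_) rfl rfl
  have hj : n - 1 - j + (j + 1) = n := by have := Finset.mem_range.1 hj; omega
  have h1 : (a * b) ^ (n - 1 - j) = (b * a) ^ (j + 1) := by
    rw [← hj, pow_add] at h
    rw [eq_inv_of_mul_eq_one_left h, ← inv_pow, mul_inv_rev, ha', hb']
  rw [h1, pow_succ]
  simp [mul_assoc, ha]

end AlternatingProducts

section GeometricRepresentation

open Polynomial.Chebyshev

theorem reflection_mul_reflection_pow_eq_one {M : Type*} [AddCommGroup M] [Module ℝ M]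
    {x y : M} {f g : Module.Dual ℝ M} (hf : f x = 2) (hg : g y = 2) {m : ℕ} (hm : 2 ≤ m)
    (hfy : f y = -2 * Real.cos (Real.pi / m)) (hgx : g x = -2 * Real.cos (Real.pi / m)) :
    (Module.reflection hf * Module.reflection hg) ^ m = 1 := by
  have hm0 : (m : ℝ) ≠ 0 := by positivity
  set φ : ℝ := 2 * Real.pi / m with hφ
  have ht : 2 * Real.cos φ = f y * g x - 2 := by
    rw [hfy, hgx, hφ, mul_div_assoc, Real.cos_two_mul]; ring
  ext z
  rcases hm.eq_or_lt with rfl | hm3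
  · have hf0 : f y = 0 := by simp [hfy]
    have hg0 : g x = 0 := by simp [hgx]
    simp only [pow_two, LinearEquiv.mul_apply, Module.reflection_apply, map_sub, map_smul, hf, hg,
      hf0, hg0, LinearEquiv.coe_one, id_eq]
    module
  have hsin : Real.sin φ ≠ 0 := by
    refine (Real.sin_pos_of_pos_of_lt_pi (by positivity) ?_).ne'
    rw [hφ, div_lt_iff₀ (by positivity)]
    have : (3 : ℝ) ≤ m := by exact_mod_cast hm3
    nlinarith [Real.pi_pos]
  have hS (n : ℤ) : (S ℝ n).eval (2 * Real.cos φ) = Real.sin ((n + 1) * φ) / Real.sin φ := by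
    rw [eq_div_iff hsin, S_two_mul_real_cos]
  have hmφ : m * φ = 2 * Real.pi := by rw [hφ]; field_simp
  rw [Module.reflection_mul_reflection_pow_apply hf hg m z _ ht]
  obtain ⟨k, rfl | rfl⟩ := Nat.even_or_odd' m
  · have e1 : (((2 * k : ℕ) : ℤ) - 2) / 2 = k - 1 := by omega
    have e2 : (((2 * k : ℕ) : ℤ) - 1) / 2 = k - 1 := by omega
    have h0 : (S ℝ ((k : ℤ) - 1)).eval (2 * Real.cos φ) = 0 := by
      rw [hS]
      have : (((k - 1 : ℤ) : ℝ) + 1) * φ = Real.pi := by push_cast at hmφ ⊢; linarith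
      rw [this, Real.sin_pi, zero_div]
    rw [e1, e2, h0]
    simp
  · have e1 : (((2 * k + 1 : ℕ) : ℤ) - 1) / 2 = k := by omega
    have e2 : (((2 * k + 1 : ℕ) : ℤ) - 3) / 2 = k - 1 := by omega
    have e3 : (((2 * k + 1 : ℕ) : ℤ) - 2) / 2 = k - 1 := by omega
    have e4 : ((2 * k + 1 : ℕ) : ℤ) / 2 = k := by omega
    have h0 : (S ℝ (k : ℤ)).eval (2 * Real.cos φ) + (S ℝ ((k : ℤ) - 1)).eval (2 * Real.cos φ) = 0 := by
      rw [hS, hS, ← add_div]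
      have : (((k : ℤ) : ℝ) + 1) * φ = 2 * Real.pi - (((k - 1 : ℤ) : ℝ) + 1) * φ := by
        push_cast at hmφ ⊢; linarith
      rw [this, Real.sin_two_pi_sub]
      simp
    rw [e1, e2, e3, e4, h0]
    simp

theorem dvd_of_reflection_mul_reflection_pow_eq_one {M : Type*} [AddCommGroup M] [Module ℝ M]
    {x y : M} {f g : Module.Dual ℝ M} (hf : f x = 2) (hg : g y = 2)
    (hxy : LinearIndependent ℝ ![x, y]) {m : ℕ} (hm : m ≠ 1)
    (hfy : f y = -2 * Real.cos (Real.pi / m)) (hgx : g x = -2 * Real.cos (Real.pi / m)) {n : ℕ}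
    (h : (Module.reflection hf * Module.reflection hg) ^ n = 1) : m ∣ n := by
  set φ : ℝ := 2 * Real.pi / m with hφ
  have ht : 2 * Real.cos φ = f y * g x - 2 := by
    rw [hfy, hgx, hφ, mul_div_assoc, Real.cos_two_mul]; ring
  have hx := Module.reflection_mul_reflection_pow_apply_self hf hg n _ ht
  rw [h, LinearEquiv.coe_one, id_eq] at hx
  have hcoef := LinearIndependent.pair_iff.1 hxy
    ((S ℝ n).eval (2 * Real.cos φ) + (S ℝ (n - 1)).eval (2 * Real.cos φ) - 1)
    ((S ℝ (n - 1)).eval (2 * Real.cos φ) * -g x) (by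
      rw [sub_smul, one_smul, sub_add_eq_add_sub, ← hx, sub_self])
  obtain ⟨h1, h2⟩ := hcoef
  rcases m with _ | _ | _ | m
  · have : (2 * Real.cos φ) = 2 := by simp [hφ]
    rw [this, S_eval_two, S_eval_two] at h1
    push_cast at h1
    have : (n : ℝ) = 0 := by linarith
    simpa using this
  · exact absurd rfl hm
  · have : (2 * Real.cos φ) = -2 := by simp [hφ]
    rw [this, S_eval_neg_two, S_eval_neg_two, Int.negOnePow_sub] at h1
    by_contra hn
    have hodd : Odd (n : ℤ) := by
      rw [← Int.not_even_iff_odd, Int.even_coe_nat]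
      exact fun he => hn (by simpa using he.two_dvd)
    rw [Int.negOnePow_odd _ hodd] at h1
    simp at h1
    linarith
  · have hsin : Real.sin φ ≠ 0 := by
      refine (Real.sin_pos_of_pos_of_lt_pi (by positivity) ?_).ne'
      rw [hφ, div_lt_iff₀ (by positivity)]
      push_cast
      nlinarith [Real.pi_pos, mul_nonneg (Nat.cast_nonneg (α := ℝ) m) Real.pi_pos.le]
    have hS (n : ℤ) : (S ℝ n).eval (2 * Real.cos φ) = Real.sin ((n + 1) * φ) / Real.sin φ := by
      rw [eq_div_iff hsin, S_two_mul_real_cos]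
    have hg0 : g x ≠ 0 := by
      have : 0 < Real.cos (Real.pi / ((m + 1 + 1 + 1 : ℕ) : ℝ)) := by
        apply Real.cos_pos_of_mem_Ioo
        constructor
        · have : 0 < Real.pi / ((m + 1 + 1 + 1 : ℕ) : ℝ) := by positivity
          linarith [Real.pi_pos]
        · apply div_lt_div_of_pos_left Real.pi_pos (by norm_num)
          push_cast
          linarith [(Nat.cast_nonneg m : (0 : ℝ) ≤ m)]
      rw [hgx]
      nlinarith
    have h3 : (S ℝ ((n : ℤ) - 1)).eval (2 * Real.cos φ) = 0 := by simpa [hg0] using h2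
    have h4 : Real.sin (n * φ) = 0 := by simpa [hS, hsin] using h3
    have h5 : Real.sin ((n + 1) * φ) = Real.sin φ := by
      rw [h3, hS] at h1
      field_simp at h1
      rw [mul_zero, add_zero] at h1
      exact_mod_cast sub_eq_zero.1 h1
    rw [add_mul, one_mul, Real.sin_add, h4, zero_mul, zero_add, mul_eq_right₀ hsin,
      Real.cos_eq_one_iff] at h5
    obtain ⟨j, hj⟩ := h5
    have h6 : (n : ℝ) = (m + 1 + 1 + 1 : ℕ) * j := by
      rw [hφ] at hj
      have := Real.pi_pos
      field_simp at hj
      linarith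
    exact Int.natCast_dvd_natCast.1 ⟨j, by exact_mod_cast h6⟩

end GeometricRepresentation

section Lifts

variable {V : Type*} (Γ : LabelledGraph V) {G : Type*} [Group G] (f : V → G)

theorem lift_artinRels
    (h : ∀ u v : V, ∀ k : ℕ, u ≠ v → Γ.m u v = k → altProd (f u) (f v) k = altProd (f v) (f u) k) :
    ∀ r ∈ Γ.artinRels, FreeGroup.lift f r = 1 := by
  rintro _ ⟨u, v, k, huv, hk, rfl⟩
  simp [altWord, map_altProd, h u v k huv hk]

/-- A family satisfying the Artin relations induces a homomorphism from the Artin group. -/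
def artinLift
    (h : ∀ u v : V, ∀ k : ℕ, u ≠ v → Γ.m u v = k → altProd (f u) (f v) k = altProd (f v) (f u) k) :
    Γ.ArtinGroup →* G :=
  PresentedGroup.toGroup (Γ.lift_artinRels f h)

@[simp]
theorem artinLift_σ (h) (v : V) : Γ.artinLift f h (Γ.σ v) = f v :=
  PresentedGroup.toGroup.of _

theorem altProd_σ_comm {u v : V} {k : ℕ} (huv : u ≠ v) (hk : Γ.m u v = k) :
    altProd (Γ.σ u) (Γ.σ v) k = altProd (Γ.σ v) (Γ.σ u) k := by
  have h : PresentedGroup.mk Γ.artinRels (altWord u v k * (altWord v u k)⁻¹) = 1 :=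
    (QuotientGroup.eq_one_iff _).2 (Subgroup.subset_normalClosure ⟨u, v, k, huv, hk, rfl⟩)
  rw [map_mul, map_inv, mul_inv_eq_one, altWord, altWord, map_altProd, map_altProd] at h
  exact h

/-- A family of involutions satisfying the Artin relations induces a homomorphism from the
Coxeter group. -/
def coxeterLift (h2 : ∀ v, f v * f v = 1)
    (h : ∀ u v : V, ∀ k : ℕ, u ≠ v → Γ.m u v = k → (f u * f v) ^ k = 1) :
    Γ.CoxeterGroupOf →* G :=
  PresentedGroup.toGroup (f := f) (by
    rintro r (hr | ⟨v, rfl⟩)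
    · exact Γ.lift_artinRels f
        (fun u v k huv hk => (altProd_comm_iff (h2 u) (h2 v) k).2 (h u v k huv hk)) r hr
    · simp [h2])

/-- The standard generators of the Coxeter group. -/
def refl (v : V) : Γ.CoxeterGroupOf := PresentedGroup.of v

@[simp]
theorem coxeterLift_refl (h2) (h) (v : V) : Γ.coxeterLift f h2 h (Γ.refl v) = f v :=
  PresentedGroup.toGroup.of _

@[simp]
theorem refl_mul_self (v : V) : Γ.refl v * Γ.refl v = 1 := by
  have h : PresentedGroup.mk (Γ.artinRels ∪ squareRels V) (FreeGroup.of v * FreeGroup.of v) = 1 :=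
    (QuotientGroup.eq_one_iff _).2 (Subgroup.subset_normalClosure (Or.inr ⟨v, rfl⟩))
  rwa [map_mul] at h

@[simp]
theorem refl_inv (v : V) : (Γ.refl v)⁻¹ = Γ.refl v :=
  inv_eq_of_mul_eq_one_left (Γ.refl_mul_self v)

@[simp]
theorem refl_mul_refl_mul (v : V) (w : Γ.CoxeterGroupOf) : Γ.refl v * (Γ.refl v * w) = w := by
  rw [← mul_assoc, refl_mul_self, one_mul]

theorem refl_mul_refl_pow {u v : V} {k : ℕ} (huv : u ≠ v) (hk : Γ.m u v = k) :
    (Γ.refl u * Γ.refl v) ^ k = 1 := by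
  have h : PresentedGroup.mk (Γ.artinRels ∪ squareRels V) (altWord u v k * (altWord v u k)⁻¹) = 1 :=
    (QuotientGroup.eq_one_iff _).2 (Subgroup.subset_normalClosure (Or.inl ⟨u, v, k, huv, hk, rfl⟩))
  rw [map_mul, map_inv, altWord, altWord, map_altProd, map_altProd] at h
  rwa [← altProd_mul_inv_altProd (Γ.refl_mul_self u) (Γ.refl_mul_self v)]

end Lifts

section GeometricRepresentation

variable {V : Type*} (Γ : LabelledGraph V)

theorem two_le_toNat {u v : V} (huv : u ≠ v) (h : Γ.m u v ≠ ⊤) : 2 ≤ (Γ.m u v).toNat := by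
  have := Γ.two_le u v huv
  rw [← ENat.natCast_toNat h] at this
  exact_mod_cast this

open Classical in
/-- The form `2 B(α_u, ·)`, for `B` the canonical bilinear form of the Coxeter group. -/
noncomputable def corootForm (u : V) : Module.Dual ℝ (V →₀ ℝ) :=
  Finsupp.linearCombination ℝ
    fun v => if u = v then 2 else -2 * Real.cos (Real.pi / (Γ.m u v).toNat)

theorem corootForm_self (u : V) : Γ.corootForm u (Finsupp.single u 1) = 2 := by
  simp [corootForm]

theorem corootForm_of_ne {u v : V} (h : u ≠ v) :
    Γ.corootForm u (Finsupp.single v 1) = -2 * Real.cos (Real.pi / (Γ.m u v).toNat) := by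
  simp [corootForm, h]

/-- The geometric representation of the Coxeter group. -/
noncomputable def geometricRep : Γ.CoxeterGroupOf →* ((V →₀ ℝ) ≃ₗ[ℝ] (V →₀ ℝ)) :=
  Γ.coxeterLift (fun v => Module.reflection (Γ.corootForm_self v))
    (fun v => by
      ext1 x
      exact Module.involutive_reflection (Γ.corootForm_self v) x)
    (fun u v k huv hk => by
      have hk' : (Γ.m u v).toNat = k := by simp [hk]
      have h2 : 2 ≤ (Γ.m u v).toNat := Γ.two_le_toNat huv (by simp [hk])
      rw [← hk']
      refine reflection_mul_reflection_pow_eq_one _ _ h2 (Γ.corootForm_of_ne huv) ?_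
      rw [Γ.corootForm_of_ne huv.symm, Γ.symm])

theorem orderOf_refl_mul_refl {u v : V} (huv : u ≠ v) :
    orderOf (Γ.refl u * Γ.refl v) = (Γ.m u v).toNat := by
  refine Nat.dvd_antisymm ?_ ?_
  · by_cases h : Γ.m u v = ⊤
    · simp [h]
    · exact orderOf_dvd_of_pow_eq_one (Γ.refl_mul_refl_pow huv (ENat.natCast_toNat h).symm)
  · have h := congrArg Γ.geometricRep (pow_orderOf_eq_one (Γ.refl u * Γ.refl v))
    rw [map_one, map_pow, map_mul, geometricRep, coxeterLift_refl, coxeterLift_refl] at h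
    refine dvd_of_reflection_mul_reflection_pow_eq_one _ _ ?_ ?_ (Γ.corootForm_of_ne huv) ?_ h
    · refine LinearIndependent.pair_iff.2 fun a b hab => ⟨?_, ?_⟩
      · simpa [huv.symm] using DFunLike.congr_fun hab u
      · simpa [huv] using DFunLike.congr_fun hab v
    · by_cases h : Γ.m u v = ⊤
      · simp [h]
      · have := Γ.two_le_toNat huv h
        omega
    · rw [Γ.corootForm_of_ne huv.symm, Γ.symm]

theorem refl_injective : Function.Injective Γ.refl := by
  intro u v h
  by_contra huv
  have ho := Γ.orderOf_refl_mul_refl huv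
  rw [h, refl_mul_self, orderOf_one] at ho
  by_cases htop : Γ.m u v = ⊤
  · simp [htop] at ho
  · have := Γ.two_le_toNat huv htop
    omega

theorem m_eq_of_orderOf_eq {u v x y : V} (huv : u ≠ v) (hxy : x ≠ y)
    (h : orderOf (Γ.refl x * Γ.refl y) = orderOf (Γ.refl u * Γ.refl v)) {k : ℕ}
    (hk : Γ.m u v = k) : Γ.m x y = k := by
  rw [Γ.orderOf_refl_mul_refl huv, Γ.orderOf_refl_mul_refl hxy] at h
  have h2 := Γ.two_le_toNat huv (by simp [hk])
  have htop : Γ.m x y ≠ ⊤ := fun hx => by simp [hx] at h; omega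
  rw [← ENat.natCast_toNat htop, h, hk, ENat.toNat_natCast]

end GeometricRepresentation

variable {V : Type*} (Γ : LabelledGraph V)

section Words

/-- The element of the Coxeter group represented by a word. -/
def wordProd (L : List V) : Γ.CoxeterGroupOf := (L.map Γ.refl).prod

@[simp]
theorem wordProd_nil : Γ.wordProd [] = 1 := rfl

@[simp]
theorem wordProd_cons (v : V) (L : List V) :
    Γ.wordProd (v :: L) = Γ.refl v * Γ.wordProd L := by
  simp [wordProd]

@[simp]
theorem wordProd_append (L L' : List V) :
    Γ.wordProd (L ++ L') = Γ.wordProd L * Γ.wordProd L' := by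
  simp [wordProd]

theorem exists_wordProd_eq_of_mem_closure {Y : Set V} {w : Γ.CoxeterGroupOf}
    (hw : w ∈ Subgroup.closure (Γ.refl '' Y)) :
    ∃ L : List V, (∀ v ∈ L, v ∈ Y) ∧ Γ.wordProd L = w := by
  induction hw using Subgroup.closure_induction with
  | mem _ h =>
    obtain ⟨v, hv, rfl⟩ := h
    exact ⟨[v], by simpa using hv, by simp⟩
  | one => exact ⟨[], by simp, rfl⟩
  | mul _ _ _ _ h₁ h₂ =>
    obtain ⟨L₁, hL₁, rfl⟩ := h₁
    obtain ⟨L₂, hL₂, rfl⟩ := h₂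
    refine ⟨L₁ ++ L₂, fun v hv => ?_, by simp⟩
    exact (List.mem_append.1 hv).elim (hL₁ v) (hL₂ v)
  | inv _ hx h =>
    obtain ⟨L, hL, rfl⟩ := h
    refine ⟨L.reverse, by simpa using hL, ?_⟩
    clear hx hL
    induction L with
    | nil => simp
    | cons v L ih => simp [ih]

theorem closure_range_refl : Subgroup.closure (Set.range Γ.refl) = ⊤ :=
  PresentedGroup.closure_range_of _

theorem exists_wordProd_eq (w : Γ.CoxeterGroupOf) : ∃ L : List V, Γ.wordProd L = w := by
  obtain ⟨L, -, hL⟩ := Γ.exists_wordProd_eq_of_mem_closure (Y := Set.univ) (w := w) (by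
    rw [Set.image_univ, closure_range_refl]; trivial)
  exact ⟨L, hL⟩

end Words

section Sign

open Classical in
/-- The action of a generator on signed elements of the Coxeter group: conjugation, changing the
sign of the generator itself. -/
noncomputable def signPerm (v : V) : Equiv.Perm (Γ.CoxeterGroupOf × ℤˣ) :=
  Function.Involutive.toPerm
    (fun p => (Γ.refl v * p.1 * Γ.refl v, (if p.1 = Γ.refl v then -1 else 1) * p.2))
    (by
      rintro ⟨g, ε⟩
      have : Γ.refl v * g * Γ.refl v = Γ.refl v ↔ g = Γ.refl v := by
        rw [mul_assoc, mul_eq_left, mul_eq_one_iff_eq_inv, refl_inv]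
      simp only [this]
      split_ifs <;> simp [mul_assoc])

open Classical in
theorem signPerm_apply (v : V) (g : Γ.CoxeterGroupOf) (ε : ℤˣ) :
    Γ.signPerm v (g, ε) = (Γ.refl v * g * Γ.refl v, (if g = Γ.refl v then -1 else 1) * ε) :=
  rfl

theorem altProdRight_signPerm (u v : V) (n : ℕ) (g : Γ.CoxeterGroupOf) (ε : ℤˣ) :
    altProdRight (Γ.signPerm u) (Γ.signPerm v) n (g, ε) =
      (altProdRight (Γ.refl u) (Γ.refl v) n * g * (altProdRight (Γ.refl u) (Γ.refl v) n)⁻¹,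
        (-1) ^ palindromeCount (Γ.refl u) (Γ.refl v) n g * ε) := by
  induction n generalizing u v g ε with
  | zero => simp [altProdRight, palindromeCount]
  | succ n ih =>
    rw [altProdRight, Equiv.Perm.mul_apply, signPerm_apply, ih,
      palindromeCount_succ (Γ.refl_mul_self u), altProdRight]
    ext1
    · simp [mul_assoc]
    · dsimp only
      rw [pow_add, mul_assoc]
      split_ifs <;> simp

/-- The action of the Coxeter group on its signed elements. -/
noncomputable def signRep : Γ.CoxeterGroupOf →* Equiv.Perm (Γ.CoxeterGroupOf × ℤˣ) :=
  have h2 : ∀ v, Γ.signPerm v * Γ.signPerm v = 1 := fun v => by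
    ext1 p
    exact (Γ.signPerm v).symm_apply_apply p
  Γ.coxeterLift Γ.signPerm h2
    (fun u v k huv hk => by
      have hpow := Γ.refl_mul_refl_pow huv hk
      rw [← altProd_comm_iff (h2 u) (h2 v), ← altProdRight_comm_iff]
      ext1 ⟨g, ε⟩
      rw [altProdRight_signPerm, altProdRight_signPerm,
        palindromeCount_comm (Γ.refl_mul_self u) (Γ.refl_mul_self v) hpow,
        (altProdRight_comm_iff _ _ k).2
          ((altProd_comm_iff (Γ.refl_mul_self u) (Γ.refl_mul_self v) k).2 hpow)])

/-- The sign that `w` gives to the positive copy of `g`. For a reflection `g`, this is `-1` if and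
only if `w * g` is shorter than `w`. -/
noncomputable def sgn (w g : Γ.CoxeterGroupOf) : ℤˣ := (Γ.signRep w (g, 1)).2

open Classical in
theorem sgn_refl (v : V) (g : Γ.CoxeterGroupOf) :
    Γ.sgn (Γ.refl v) g = if g = Γ.refl v then -1 else 1 := by
  rw [sgn, signRep, coxeterLift_refl, signPerm_apply, mul_one]

theorem sgn_refl_eq_neg_one_iff {v : V} {g : Γ.CoxeterGroupOf} :
    Γ.sgn (Γ.refl v) g = -1 ↔ g = Γ.refl v := by
  classical
  rw [sgn_refl]
  split_ifs with h <;> simp [h]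

theorem signRep_apply (w g : Γ.CoxeterGroupOf) (ε : ℤˣ) :
    Γ.signRep w (g, ε) = (w * g * w⁻¹, Γ.sgn w g * ε) := by
  classical
  obtain ⟨L, rfl⟩ := Γ.exists_wordProd_eq w
  induction L generalizing g ε with
  | nil => simp [sgn]
  | cons v L ih =>
    have key (ε : ℤˣ) : Γ.signRep (Γ.wordProd (v :: L)) (g, ε) =
        Γ.signPerm v (Γ.wordProd L * g * (Γ.wordProd L)⁻¹, Γ.sgn (Γ.wordProd L) g * ε) := by
      rw [wordProd_cons, map_mul, Equiv.Perm.mul_apply, ih, signRep, coxeterLift_refl]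
    rw [sgn, key, key, signPerm_apply, signPerm_apply]
    simp [mul_assoc]

@[simp]
theorem sgn_one (g : Γ.CoxeterGroupOf) : Γ.sgn 1 g = 1 := by simp [sgn]

theorem sgn_mul (w w' g : Γ.CoxeterGroupOf) :
    Γ.sgn (w * w') g = Γ.sgn w (w' * g * w'⁻¹) * Γ.sgn w' g := by
  rw [sgn, map_mul, Equiv.Perm.mul_apply, signRep_apply, signRep_apply, mul_one]

theorem refl_ne_one (v : V) : Γ.refl v ≠ 1 := by
  intro h
  have := (Γ.sgn_refl_eq_neg_one_iff (v := v)).2 rfl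
  rw [h, sgn_one] at this
  exact absurd this (by decide)

/-- The strong exchange property. -/
theorem exists_wordProd_eq_mul_of_sgn_eq_neg_one {L : List V} {g : Γ.CoxeterGroupOf}
    (h : Γ.sgn (Γ.wordProd L) g = -1) :
    ∃ L' : List V, L'.length < L.length ∧ L' ⊆ L ∧ Γ.wordProd L' = Γ.wordProd L * g := by
  induction L with
  | nil => exact absurd h (by simp)
  | cons v L ih =>
    rcases Int.units_eq_one_or (Γ.sgn (Γ.wordProd L) g) with hL | hL
    · rw [wordProd_cons, sgn_mul, hL, mul_one, sgn_refl_eq_neg_one_iff,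
        mul_inv_eq_iff_eq_mul] at h
      exact ⟨L, by simp, by simp, by rw [wordProd_cons, mul_assoc, h, refl_mul_refl_mul]⟩
    · obtain ⟨L', hlen, hsub, hL'⟩ := ih hL
      exact ⟨v :: L', by simpa using hlen, List.cons_subset_cons v hsub, by
        rw [wordProd_cons, hL', wordProd_cons, mul_assoc]⟩

theorem eq_one_of_sgn_eq_one {Y : Set V} {d : Γ.CoxeterGroupOf}
    (hd : d ∈ Subgroup.closure (Γ.refl '' Y)) (h : ∀ y ∈ Y, Γ.sgn d (Γ.refl y) = 1) : d = 1 := by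
  obtain ⟨L, hL, rfl⟩ := Γ.exists_wordProd_eq_of_mem_closure hd
  clear hd
  induction hn : L.length using Nat.strong_induction_on generalizing L with
  | _ n ih =>
    subst hn
    rcases L.eq_nil_or_concat' with rfl | ⟨L₀, y, rfl⟩
    · rfl
    have hy := h y (hL y (by simp))
    rw [wordProd_append, sgn_mul] at hy
    simp only [wordProd_cons, wordProd_nil, mul_one, refl_inv, refl_mul_self, one_mul,
      Γ.sgn_refl_eq_neg_one_iff.2 rfl] at hy
    obtain ⟨L', hlen, hsub, hL'⟩ := Γ.exists_wordProd_eq_mul_of_sgn_eq_neg_one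
      (L := L₀) (g := Γ.refl y) (by simpa [neg_eq_iff_eq_neg] using hy)
    have heq : Γ.wordProd (L₀ ++ [y]) = Γ.wordProd L' := by simp [hL']
    rw [heq] at h ⊢
    exact ih L'.length (by simp; omega) L'
      (fun v hv => hL v (List.mem_append_left _ (hsub hv))) h rfl

theorem exists_sgn_eq_neg_one {Y : Set V} {d : Γ.CoxeterGroupOf}
    (hd : d ∈ Subgroup.closure (Γ.refl '' Y)) (h1 : d ≠ 1) :
    ∃ y ∈ Y, Γ.sgn d (Γ.refl y) = -1 := by
  by_contra! h
  exact h1 (Γ.eq_one_of_sgn_eq_one hd fun y hy =>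
    (Int.units_eq_one_or _).resolve_right (h y hy))

theorem mem_of_refl_mem_closure {Y : Set V} {x : V}
    (hx : Γ.refl x ∈ Subgroup.closure (Γ.refl '' Y)) : x ∈ Y := by
  obtain ⟨y, hy, h⟩ := Γ.exists_sgn_eq_neg_one hx (Γ.refl_ne_one x)
  rwa [← Γ.refl_injective (Γ.sgn_refl_eq_neg_one_iff.1 h)]

/-- Every element is a product of an element of a standard parabolic subgroup and the inverse of
an element which is minimal in its coset. -/
theorem exists_minimal_coset_rep (Y : Set V) (u : Γ.CoxeterGroupOf) :
    ∃ d q, d ∈ Subgroup.closure (Γ.refl '' Y) ∧ u = d * q⁻¹ ∧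
      ∀ g ∈ Subgroup.closure (Γ.refl '' Y), Γ.sgn q g = 1 := by
  classical
  have hex : ∃ n, ∃ L : List V, L.length = n ∧
      u * Γ.wordProd L ∈ Subgroup.closure (Γ.refl '' Y) := by
    obtain ⟨L, hL⟩ := Γ.exists_wordProd_eq u⁻¹
    exact ⟨_, L, rfl, by simp [hL, one_mem]⟩
  obtain ⟨L, hlen, hL⟩ := Nat.find_spec hex
  refine ⟨_, Γ.wordProd L, hL, by simp, fun g hg => ?_⟩
  refine (Int.units_eq_one_or _).resolve_right fun hneg => ?_
  obtain ⟨L', hlt, -, hL'⟩ := Γ.exists_wordProd_eq_mul_of_sgn_eq_neg_one hneg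
  refine Nat.find_min hex (hlen ▸ hlt) ⟨L', rfl, ?_⟩
  rw [hL', ← mul_assoc]
  exact mul_mem hL hg

theorem exists_conj_refl_eq {Y : Set V} {q : Γ.CoxeterGroupOf}
    (hq : ∀ g ∈ Subgroup.closure (Γ.refl '' Y), Γ.sgn q g = 1) {x : V}
    (hx : q⁻¹ * Γ.refl x * q ∈ Subgroup.closure (Γ.refl '' Y)) :
    ∃ y ∈ Y, q⁻¹ * Γ.refl x * q = Γ.refl y := by
  have h1 : q⁻¹ * Γ.refl x * q ≠ 1 := by
    rw [mul_assoc, Ne, inv_mul_eq_one, eq_comm, mul_eq_right]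
    exact Γ.refl_ne_one x
  obtain ⟨y, hy, hneg⟩ := Γ.exists_sgn_eq_neg_one hx h1
  have hyY : Γ.refl y ∈ Subgroup.closure (Γ.refl '' Y) :=
    Subgroup.subset_closure (Set.mem_image_of_mem _ hy)
  have h2 := Γ.sgn_mul q (q⁻¹ * Γ.refl x * q) (Γ.refl y)
  rw [hq _ (mul_mem (mul_mem hx hyY) (inv_mem hx)), hneg, ← mul_assoc, ← mul_assoc,
    mul_inv_cancel, one_mul, sgn_mul, hq _ hyY, mul_one, one_mul, sgn_refl_eq_neg_one_iff] at h2
  refine ⟨y, hy, ?_⟩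
  rw [← h2]
  simp [mul_assoc]

theorem conj_refl_eq_of_mem_closure_pair {s t x y : V} {u : Γ.CoxeterGroupOf} (hxy : x ≠ y)
    (hx : Γ.sgn u (Γ.refl x) = 1) (hy : Γ.sgn u (Γ.refl y) = 1)
    (hxD : u * Γ.refl x * u⁻¹ ∈ Subgroup.closure (Γ.refl '' {s, t}))
    (hyD : u * Γ.refl y * u⁻¹ ∈ Subgroup.closure (Γ.refl '' {s, t})) :
    (u * Γ.refl x * u⁻¹ = Γ.refl s ∧ u * Γ.refl y * u⁻¹ = Γ.refl t) ∨
    (u * Γ.refl x * u⁻¹ = Γ.refl t ∧ u * Γ.refl y * u⁻¹ = Γ.refl s) := by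
  obtain ⟨d, q, hd, rfl, hq⟩ := Γ.exists_minimal_coset_rep {s, t} u
  have hmem {z : V} (hz : d * q⁻¹ * Γ.refl z * (d * q⁻¹)⁻¹ ∈ Subgroup.closure (Γ.refl '' {s, t})) :
      q⁻¹ * Γ.refl z * q ∈ Subgroup.closure (Γ.refl '' {s, t}) := by
    have := mul_mem (mul_mem (inv_mem hd) hz) hd
    simpa [mul_assoc] using this
  have hsgn {z : V} (hz : Γ.sgn (d * q⁻¹) (Γ.refl z) = 1)
      (hzD : q⁻¹ * Γ.refl z * q ∈ Subgroup.closure (Γ.refl '' {s, t})) :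
      Γ.sgn d (q⁻¹ * Γ.refl z * q) = 1 := by
    have h1 := Γ.sgn_mul q q⁻¹ (Γ.refl z)
    rw [mul_inv_cancel, sgn_one, inv_inv, hq _ hzD, one_mul] at h1
    rwa [sgn_mul, inv_inv, ← h1, mul_one] at hz
  have hxD' := hmem hxD
  have hyD' := hmem hyD
  have hsx := hsgn hx hxD'
  have hsy := hsgn hy hyD'
  obtain ⟨a, ha, hax⟩ := Γ.exists_conj_refl_eq hq hxD'
  obtain ⟨b, hb, hby⟩ := Γ.exists_conj_refl_eq hq hyD'
  have hab : a ≠ b := by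
    rintro rfl
    rw [← hby, mul_left_inj, mul_right_inj] at hax
    exact hxy (Γ.refl_injective hax)
  rw [hax] at hsx
  rw [hby] at hsy
  have key : (a = s ∧ b = t) ∨ (a = t ∧ b = s) := by
    simp only [Set.mem_insert_iff, Set.mem_singleton_iff] at ha hb
    grind
  have hd1 : d = 1 := Γ.eq_one_of_sgn_eq_one hd fun z hz => by
    simp only [Set.mem_insert_iff, Set.mem_singleton_iff] at hz
    grind
  subst hd1
  simp only [one_mul, inv_inv, hax, hby]
  rcases key with ⟨rfl, rfl⟩ | ⟨rfl, rfl⟩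
  exacts [Or.inl ⟨rfl, rfl⟩, Or.inr ⟨rfl, rfl⟩]

end Sign

section Retraction

/-- The elements of the Coxeter group which are minimal in their left coset of the standard
parabolic subgroup generated by `X`. -/
abbrev MinCoset (X : Set V) : Type _ := {u : Γ.CoxeterGroupOf // ∀ x ∈ X, Γ.sgn u (Γ.refl x) = 1}

variable {Γ} {X : Set V}

/-- Left multiplication of a minimal coset representative by a generator that moves its coset. -/
def MinCoset.smul (p : V) (u : Γ.MinCoset X)
    (h : ¬ ∃ x ∈ X, u.1 * Γ.refl x * u.1⁻¹ = Γ.refl p) : Γ.MinCoset X :=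
  ⟨Γ.refl p * u.1, fun x hx => by
    rw [sgn_mul, u.2 x hx, mul_one]
    refine (Int.units_eq_one_or _).resolve_right fun hneg => h ⟨x, hx, ?_⟩
    exact Γ.sgn_refl_eq_neg_one_iff.1 hneg⟩

open Classical in
/-- The action of a generator on `ArtinGroup × MinCoset X` by the Reidemeister–Schreier rewriting
process, where `τ` records the generators that fix a coset. -/
noncomputable def stepFun (τ : V → Γ.ArtinGroup) (p : V) (z : Γ.ArtinGroup × Γ.MinCoset X) :
    Γ.ArtinGroup × Γ.MinCoset X :=
  if h : ∃ x ∈ X, z.2.1 * Γ.refl x * z.2.1⁻¹ = Γ.refl p then (τ h.choose * z.1, z.2)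
  else (z.1, z.2.smul p h)

theorem stepFun_of_eq (τ : V → Γ.ArtinGroup) {p x : V} (hx : x ∈ X) (a : Γ.ArtinGroup)
    {u : Γ.MinCoset X} (h : u.1 * Γ.refl x * u.1⁻¹ = Γ.refl p) :
    stepFun τ p (a, u) = (τ x * a, u) := by
  have hex : ∃ x ∈ X, u.1 * Γ.refl x * u.1⁻¹ = Γ.refl p := ⟨x, hx, h⟩
  have hc : hex.choose = x := Γ.refl_injective (by
    have := hex.choose_spec.2.trans h.symm
    rwa [mul_left_inj, mul_right_inj] at this)
  rw [stepFun, dif_pos hex, hc]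

theorem stepFun_of_not (τ : V → Γ.ArtinGroup) {p : V} (a : Γ.ArtinGroup) {u : Γ.MinCoset X}
    (h : ¬ ∃ x ∈ X, u.1 * Γ.refl x * u.1⁻¹ = Γ.refl p) :
    stepFun τ p (a, u) = (a, u.smul p h) :=
  dif_neg h

theorem stepFun_stepFun {τ τ' : V → Γ.ArtinGroup} (hτ : ∀ v, τ v * τ' v = 1) (p : V)
    (z : Γ.ArtinGroup × Γ.MinCoset X) : stepFun τ p (stepFun τ' p z) = z := by
  obtain ⟨a, u⟩ := z
  by_cases h : ∃ x ∈ X, u.1 * Γ.refl x * u.1⁻¹ = Γ.refl p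
  · obtain ⟨x, hx, hxp⟩ := h
    rw [stepFun_of_eq _ hx _ hxp, stepFun_of_eq _ hx _ hxp, ← mul_assoc, hτ, one_mul]
  · have h' : ¬ ∃ x ∈ X, (u.smul p h).1 * Γ.refl x * (u.smul p h).1⁻¹ = Γ.refl p := by
      rintro ⟨x, hx, hxp⟩
      change Γ.refl p * u.1 * _ * (Γ.refl p * u.1)⁻¹ = _ at hxp
      refine h ⟨x, hx, ?_⟩
      calc u.1 * Γ.refl x * u.1⁻¹
          = Γ.refl p * (Γ.refl p * u.1 * Γ.refl x * (Γ.refl p * u.1)⁻¹) * Γ.refl p := by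
            simp [mul_assoc]
        _ = Γ.refl p := by rw [hxp, refl_mul_self, one_mul]
    rw [stepFun_of_not _ _ h, stepFun_of_not _ _ h']
    ext1
    · rfl
    · exact Subtype.ext (Γ.refl_mul_refl_mul p u.1)

variable (Γ X) in
/-- The permutation of `ArtinGroup × MinCoset X` by which a generator acts. -/
noncomputable def stepPerm (p : V) : Equiv.Perm (Γ.ArtinGroup × Γ.MinCoset X) where
  toFun := stepFun Γ.σ p
  invFun := stepFun (fun v => (Γ.σ v)⁻¹) p
  left_inv := stepFun_stepFun (fun _ => inv_mul_cancel _) p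
  right_inv := stepFun_stepFun (fun _ => mul_inv_cancel _) p

theorem stepPerm_of_eq {p x : V} (hx : x ∈ X) (a : Γ.ArtinGroup) {u : Γ.MinCoset X}
    (h : u.1 * Γ.refl x * u.1⁻¹ = Γ.refl p) : stepPerm Γ X p (a, u) = (Γ.σ x * a, u) :=
  stepFun_of_eq Γ.σ hx a h

theorem stepPerm_of_not {p : V} (a : Γ.ArtinGroup) {u : Γ.MinCoset X}
    (h : ¬ ∃ x ∈ X, u.1 * Γ.refl x * u.1⁻¹ = Γ.refl p) :
    stepPerm Γ X p (a, u) = (a, u.smul p h) :=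
  stepFun_of_not Γ.σ a h

theorem altProdRight_stepPerm_of_eq {p q x y : V} (hx : x ∈ X) (hy : y ∈ X) {u : Γ.MinCoset X}
    (hxp : u.1 * Γ.refl x * u.1⁻¹ = Γ.refl p) (hyq : u.1 * Γ.refl y * u.1⁻¹ = Γ.refl q)
    (n : ℕ) (a : Γ.ArtinGroup) :
    altProdRight (stepPerm Γ X p) (stepPerm Γ X q) n (a, u) =
      (altProdRight (Γ.σ x) (Γ.σ y) n * a, u) := by
  induction n generalizing p q x y a with
  | zero => simp [altProdRight]
  | succ n ih =>
    rw [altProdRight, Equiv.Perm.mul_apply, stepPerm_of_eq hx _ hxp, ih hy hx hyq hxp,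
      altProdRight, mul_assoc]

theorem altProdRight_stepPerm_of_unique {D : Subgroup Γ.CoxeterGroupOf} {p q x : V}
    (hp : Γ.refl p ∈ D) (hq : Γ.refl q ∈ D) (hx : x ∈ X) {u : Γ.MinCoset X}
    (hu : ∀ y ∈ X, u.1 * Γ.refl y * u.1⁻¹ ∈ D → y = x) (n : ℕ) (a : Γ.ArtinGroup) :
    let δ := u.1 * Γ.refl x * u.1⁻¹
    let N := palindromeCount (Γ.refl p) (Γ.refl q) n δ
    let z := altProdRight (stepPerm Γ X p) (stepPerm Γ X q) n (a, u)
    z.1 = Γ.σ x ^ N * a ∧ z.2.1 = altProdRight (Γ.refl p) (Γ.refl q) n * δ ^ N * u.1 := by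
  classical
  induction n generalizing p q u a with
  | zero => simp [altProdRight, palindromeCount]
  | succ n ih =>
    intro δ N z
    have hN : N = palindromeCount (Γ.refl q) (Γ.refl p) n (Γ.refl p * δ * Γ.refl p) +
      if δ = Γ.refl p then 1 else 0 := palindromeCount_succ (Γ.refl_mul_self p) _ n δ
    have hz : z = altProdRight (stepPerm Γ X q) (stepPerm Γ X p) n (stepPerm Γ X p (a, u)) := rfl
    clear_value N z
    by_cases hδ : δ = Γ.refl p
    · rw [stepPerm_of_eq hx a hδ] at hz
      obtain ⟨h1, h2⟩ := ih hq hp hu (Γ.σ x * a)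
      rw [if_pos hδ, hδ, refl_mul_self, one_mul] at hN
      change u.1 * Γ.refl x * u.1⁻¹ = Γ.refl p at hδ
      rw [hδ] at h1 h2
      subst hz hN
      refine ⟨by rw [h1, pow_succ, mul_assoc], ?_⟩
      rw [h2]
      change _ = _ * (u.1 * Γ.refl x * u.1⁻¹) ^ _ * _
      rw [hδ, altProdRight, pow_succ']
      simp [mul_assoc]
    · have hmiss : ¬ ∃ y ∈ X, u.1 * Γ.refl y * u.1⁻¹ = Γ.refl p := by
        rintro ⟨y, hy, hyp⟩
        obtain rfl := hu y hy (hyp ▸ hp)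
        exact hδ hyp
      rw [stepPerm_of_not a hmiss] at hz
      have hconj (y : V) : (u.smul p hmiss).1 * Γ.refl y * (u.smul p hmiss).1⁻¹ =
          Γ.refl p * (u.1 * Γ.refl y * u.1⁻¹) * Γ.refl p := by
        simp [MinCoset.smul, mul_assoc]
      obtain ⟨h1, h2⟩ := ih (u := u.smul p hmiss) hq hp (fun y hy hyD => hu y hy (by
        rw [hconj] at hyD
        have := mul_mem (mul_mem hp hyD) hp
        simpa [mul_assoc] using this)) a
      rw [hconj] at h1 h2
      rw [if_neg hδ, add_zero] at hN
      subst hz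
      rw [← hN] at h1 h2
      refine ⟨h1, ?_⟩
      rw [h2, altProdRight]
      change _ * (_ * δ * _) ^ _ * (_ * _) = _
      rw [mul_assoc, mul_assoc (Γ.refl p), ← mul_assoc _ (Γ.refl p) u.1, mul_pow_mul]
      simp [mul_assoc]

theorem stepPerm_braid (hX : X.Nonempty) {s t : V} {k : ℕ} (hst : s ≠ t) (hk : Γ.m s t = k) :
    altProd (stepPerm Γ X s) (stepPerm Γ X t) k = altProd (stepPerm Γ X t) (stepPerm Γ X s) k := by
  rw [← altProdRight_comm_iff]
  ext1 ⟨a, u⟩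
  set D := Subgroup.closure (Γ.refl '' {s, t}) with hD
  by_cases h : ∃ x ∈ X, ∃ y ∈ X, x ≠ y ∧ u.1 * Γ.refl x * u.1⁻¹ ∈ D ∧
      u.1 * Γ.refl y * u.1⁻¹ ∈ D
  · obtain ⟨x, hx, y, hy, hxs, hyt, hxy⟩ : ∃ x ∈ X, ∃ y ∈ X, u.1 * Γ.refl x * u.1⁻¹ = Γ.refl s ∧
        u.1 * Γ.refl y * u.1⁻¹ = Γ.refl t ∧ x ≠ y := by
      obtain ⟨x, hx, y, hy, hxy, hxD, hyD⟩ := h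
      rcases Γ.conj_refl_eq_of_mem_closure_pair hxy (u.2 x hx) (u.2 y hy) hxD hyD with
        ⟨h1, h2⟩ | ⟨h1, h2⟩
      exacts [⟨x, hx, y, hy, h1, h2, hxy⟩, ⟨y, hy, x, hx, h2, h1, hxy.symm⟩]
    rw [altProdRight_stepPerm_of_eq hx hy hxs hyt, altProdRight_stepPerm_of_eq hy hx hyt hxs,
      (altProdRight_comm_iff _ _ k).2 (Γ.altProd_σ_comm hxy (Γ.m_eq_of_orderOf_eq hst hxy ?_ hk))]
    rw [← hxs, ← hyt, ← MulAut.conj_apply, ← MulAut.conj_apply, ← map_mul]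
    exact (MulEquiv.orderOf_eq _ _).symm
  · obtain ⟨x, hx, hu⟩ : ∃ x ∈ X, ∀ y ∈ X, u.1 * Γ.refl y * u.1⁻¹ ∈ D → y = x := by
      by_cases h' : ∃ x ∈ X, u.1 * Γ.refl x * u.1⁻¹ ∈ D
      · obtain ⟨x, hx, hxD⟩ := h'
        exact ⟨x, hx, fun y hy hyD => by_contra fun hne => h ⟨y, hy, x, hx, hne, hyD, hxD⟩⟩
      · obtain ⟨x, hx⟩ := hX
        exact ⟨x, hx, fun y hy hyD => absurd ⟨y, hy, hyD⟩ h'⟩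
    have hs : Γ.refl s ∈ D := Subgroup.subset_closure (Set.mem_image_of_mem _ (by simp))
    have ht : Γ.refl t ∈ D := Subgroup.subset_closure (Set.mem_image_of_mem _ (by simp))
    have hpow := Γ.refl_mul_refl_pow hst hk
    obtain ⟨h1, h2⟩ := altProdRight_stepPerm_of_unique hs ht hx hu k a
    obtain ⟨h3, h4⟩ := altProdRight_stepPerm_of_unique ht hs hx hu k a
    rw [← palindromeCount_comm (Γ.refl_mul_self s) (Γ.refl_mul_self t) hpow] at h3 h4
    rw [← (altProdRight_comm_iff _ _ k).2
      ((altProd_comm_iff (Γ.refl_mul_self s) (Γ.refl_mul_self t) k).2 hpow)] at h4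
    exact Prod.ext (h1.trans h3.symm) (Subtype.ext (h2.trans h4.symm))

variable (Γ) in
/-- The action of the Artin group on `ArtinGroup × MinCoset X`. -/
noncomputable def cosetRep (hX : X.Nonempty) :
    Γ.ArtinGroup →* Equiv.Perm (Γ.ArtinGroup × Γ.MinCoset X) :=
  Γ.artinLift (stepPerm Γ X) fun _ _ _ huv hk => stepPerm_braid hX huv hk

theorem cosetRep_apply_one (hX : X.Nonempty) {g : Γ.ArtinGroup} (hg : g ∈ Γ.specialSubgroup X)
    (a : Γ.ArtinGroup) :
    Γ.cosetRep hX g (a, ⟨1, fun _ _ => Γ.sgn_one _⟩) = (g * a, ⟨1, fun _ _ => Γ.sgn_one _⟩) := by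
  induction hg using Subgroup.closure_induction generalizing a with
  | mem _ h =>
    obtain ⟨x, hx, rfl⟩ := h
    rw [cosetRep, artinLift_σ, stepPerm_of_eq hx _ (by simp)]
  | one => simp
  | mul g h _ _ hg hh => rw [map_mul, Equiv.Perm.mul_apply, hh, hg, mul_assoc]
  | inv g _ hg =>
    rw [map_inv, Equiv.Perm.inv_eq_iff_eq, hg, mul_inv_cancel_left]

theorem cosetRep_mem_iff (hX : X.Nonempty) {Y : Set V} {g : Γ.ArtinGroup}
    (hg : g ∈ Γ.specialSubgroup Y) (z : Γ.ArtinGroup × Γ.MinCoset X) :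
    ((Γ.cosetRep hX g z).1 ∈ Γ.specialSubgroup (X ∩ Y) ∧
      (Γ.cosetRep hX g z).2.1 ∈ Subgroup.closure (Γ.refl '' Y)) ↔
    (z.1 ∈ Γ.specialSubgroup (X ∩ Y) ∧ z.2.1 ∈ Subgroup.closure (Γ.refl '' Y)) := by
  induction hg using Subgroup.closure_induction generalizing z with
  | mem _ h =>
    obtain ⟨p, hp, rfl⟩ := h
    obtain ⟨a, u⟩ := z
    have hpY : Γ.refl p ∈ Subgroup.closure (Γ.refl '' Y) :=
      Subgroup.subset_closure (Set.mem_image_of_mem _ hp)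
    rw [cosetRep, artinLift_σ]
    by_cases h : ∃ x ∈ X, u.1 * Γ.refl x * u.1⁻¹ = Γ.refl p
    · obtain ⟨x, hx, hxp⟩ := h
      rw [stepPerm_of_eq hx a hxp]
      refine and_congr_left fun hu => Subgroup.mul_mem_cancel_left _ ?_
      refine Subgroup.subset_closure (Set.mem_image_of_mem _ ⟨hx, Γ.mem_of_refl_mem_closure ?_⟩)
      rw [mul_inv_eq_iff_eq_mul, ← eq_inv_mul_iff_mul_eq] at hxp
      exact hxp ▸ mul_mem (inv_mem hu) (mul_mem hpY hu)
    · rw [stepPerm_of_not a h]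
      exact and_congr_right fun _ => Subgroup.mul_mem_cancel_left _ hpY
  | one => simp
  | mul g h _ _ hg hh => rw [map_mul, Equiv.Perm.mul_apply, hg, hh]
  | inv g _ hg => rw [← hg, map_inv, ← Equiv.Perm.mul_apply, mul_inv_cancel, Equiv.Perm.one_apply]

end Retraction

theorem specialSubgroup_inf_le (X Y : Set V) :
    Γ.specialSubgroup X ⊓ Γ.specialSubgroup Y ≤ Γ.specialSubgroup (X ∩ Y) := by
  rcases X.eq_empty_or_nonempty with rfl | hX
  · rw [Set.empty_inter]
    exact inf_le_left
  · rintro g ⟨hgX, hgY⟩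
    have h := (cosetRep_mem_iff hX hgY (1, ⟨1, fun _ _ => Γ.sgn_one _⟩)).2
      ⟨one_mem _, one_mem _⟩
    rw [cosetRep_apply_one hX hgX, mul_one] at h
    exact h.1

theorem σ_notMem_specialSubgroup {v : V} {X : Set V} (hv : v ∉ X) :
    Γ.σ v ∉ Γ.specialSubgroup X := by
  intro h
  have h' : Γ.σ v ∈ Γ.specialSubgroup ({v} ∩ X) := Γ.specialSubgroup_inf_le _ _
    ⟨Subgroup.subset_closure (Set.mem_image_of_mem _ rfl), h⟩
  rw [Set.singleton_inter_eq_empty.2 hv, specialSubgroup, Set.image_empty,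
    Subgroup.closure_empty, Subgroup.mem_bot] at h'
  have := congrArg Γ.artinToCoxeter h'
  rw [map_one] at this
  exact Γ.refl_ne_one v this

section Amalgam

variable {A : Type*} [Group A] {G : Bool → Subgroup A}

/-- `Alternates G i j L` says that the elements of `L` lie alternately in exactly one of the two
subgroups, the first in `G i`, and that the next one should lie in `G j`. -/
inductive Alternates (G : Bool → Subgroup A) : Bool → Bool → List A → Prop
  | nil (i : Bool) : Alternates G i i []
  | cons {i j : Bool} {g : A} {L : List A} (h : g ∈ G i) (h' : g ∉ G !i)
      (hL : Alternates G (!i) j L) : Alternates G i j (g :: L)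

namespace Alternates

theorem singleton {i : Bool} {g : A} (h : g ∈ G i) (h' : g ∉ G !i) : Alternates G i (!i) [g] :=
  cons h h' (nil _)

theorem append {i j k : Bool} {L L' : List A} (h : Alternates G i j L) (h' : Alternates G j k L') :
    Alternates G i k (L ++ L') := by
  induction h with
  | nil => exact h'
  | cons hg hg' _ ih => exact cons hg hg' (ih h')

theorem reverse_inv {i j : Bool} {L : List A} (h : Alternates G i j L) :
    Alternates G (!j) (!i) (L.map (·⁻¹)).reverse := by
  induction h with
  | nil => exact nil _
  | cons hg hg' _ ih =>
    rw [Bool.not_not] at ih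
    rw [List.map_cons, List.reverse_cons]
    exact ih.append (singleton (inv_mem hg) (by rwa [inv_mem_iff]))

theorem exists_prod_mul {i j : Bool} {L : List A} (hL : Alternates G i j L) (hne : L ≠ [])
    {k : Bool} {g : A} (hg : g ∈ G k) : (∀ k, g * L.prod ∈ G k) ∨
      ∃ i j L', Alternates G i j L' ∧ L' ≠ [] ∧ L'.prod = g * L.prod := by
  by_cases hg' : g ∈ G !k
  · have hgi : g ∈ G i ∧ g ∈ G !i := by cases k <;> cases i <;> simp_all
    cases hL with
    | nil => simp at hne
    | @cons _ _ b L hb hb' hL =>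
      refine Or.inr ⟨i, j, (g * b) :: L, cons (mul_mem hgi.1 hb) ?_ hL, by simp,
        by simp [mul_assoc]⟩
      rwa [Subgroup.mul_mem_cancel_left _ hgi.2]
  · rcases eq_or_ne i k with rfl | hik
    · cases hL with
      | nil => simp at hne
      | @cons _ _ b L hb hb' hL =>
        by_cases hgb : g * b ∈ G !i
        · rw [List.prod_cons, ← mul_assoc]
          have hgb' : ∀ k, g * b ∈ G k := by
            intro k
            rcases eq_or_ne k i with rfl | hk
            · exact mul_mem hg hb
            · rwa [Bool.eq_not_of_ne hk]
          cases hL with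
          | nil => exact Or.inl fun k => by simpa using hgb' k
          | @cons _ _ c L hc hc' hL =>
            refine Or.inr ⟨!i, j, (g * b * c) :: L, cons (mul_mem hgb hc) ?_ hL, by simp,
              by simp [mul_assoc]⟩
            rwa [Subgroup.mul_mem_cancel_left _ (hgb' _)]
        · exact Or.inr ⟨i, j, (g * b) :: L, cons (mul_mem hg hb) hgb hL, by simp,
            by simp [mul_assoc]⟩
    · refine Or.inr ⟨k, j, g :: L, cons hg hg' ?_, by simp, by simp⟩
      rwa [← Bool.eq_not_of_ne hik]

theorem exists_of_iSup_eq_top (htop : ⨆ i, G i = ⊤) (a : A) :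
    (∀ i, a ∈ G i) ∨ ∃ i j L, Alternates G i j L ∧ L ≠ [] ∧ L.prod = a := by
  have key {k : Bool} {g a : A} (hg : g ∈ G k)
      (ha : (∀ i, a ∈ G i) ∨ ∃ i j L, Alternates G i j L ∧ L ≠ [] ∧ L.prod = a) :
      (∀ i, g * a ∈ G i) ∨ ∃ i j L, Alternates G i j L ∧ L ≠ [] ∧ L.prod = g * a := by
    rcases ha with ha | ⟨i, j, L, hL, hne, rfl⟩
    · by_cases hg' : g ∈ G !k
      · exact Or.inl fun i => mul_mem (by cases k <;> cases i <;> assumption) (ha i)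
      · refine Or.inr ⟨k, !k, [g * a], singleton (mul_mem hg (ha k)) ?_, by simp, by simp⟩
        rwa [Subgroup.mul_mem_cancel_right _ (ha _)]
    · exact hL.exists_prod_mul hne hg
  have ha : a ∈ Subgroup.closure (⋃ i, (G i : Set A)) := by
    rw [← Subgroup.iSup_eq_closure, htop]
    trivial
  induction ha using Subgroup.closure_induction_left with
  | one => exact Or.inl fun i => one_mem _
  | mul_left g hg a _ ih =>
    obtain ⟨k, hk⟩ := Set.mem_iUnion.1 hg
    exact key hk ih
  | inv_mul_cancel g hg a _ ih =>
    obtain ⟨k, hk⟩ := Set.mem_iUnion.1 hg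
    exact key (inv_mem hk) ih

/-- If no nontrivial alternating product is trivial, the center lies in the amalgamated subgroup. -/
theorem mem_of_mem_center (htop : ⨆ i, G i = ⊤) (hproper : ∀ i, ∃ b ∈ G i, b ∉ G !i)
    (hfree : ∀ i j L, Alternates G i j L → L ≠ [] → L.prod ≠ 1) {z : A}
    (hz : z ∈ Subgroup.center A) (i : Bool) : z ∈ G i := by
  refine (exists_of_iSup_eq_top htop z).elim (fun h => h i) ?_
  rintro ⟨i, j, L, hL, hne, rfl⟩
  rw [Subgroup.mem_center_iff] at hz
  rcases eq_or_ne j i with rfl | hji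
  · cases hL with
    | nil => simp at hne
    | @cons _ _ g L hg hg' hL =>
      refine absurd ?_ (hfree _ _ _ ((hL.append (singleton hg hg')).append
        (cons hg hg' hL).reverse_inv) (by simp))
      rw [List.prod_append, ← List.prod_inv_reverse, mul_inv_eq_one]
      have := hz g
      rw [List.prod_cons, mul_assoc, mul_right_inj] at this
      simpa using this.symm
  · obtain rfl := Bool.eq_not_of_ne hji
    obtain ⟨b, hb, hb'⟩ := hproper !i
    rw [Bool.not_not] at hb'
    have h1 : Alternates G (!i) i [b] := by simpa using singleton hb (by simpa using hb')
    have h2 : Alternates G i (!i) (L.map (·⁻¹)).reverse := by simpa using hL.reverse_inv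
    refine absurd ?_ (hfree _ _ _ (((hL.append h1).append h2).append h1.reverse_inv) (by simp))
    simp only [List.prod_append, ← List.prod_inv_reverse, List.prod_singleton]
    rw [← hz b]
    simp

open Monoid in
theorem exists_word {i j : Bool} {L : List A} (hL : Alternates G i j L)
    {φ : ∀ i, (⨅ i, G i : Subgroup A) →* G i} (hφ : ∀ i x, (φ i x : A) = x) (f : A →* PushoutI φ)
    (hf : ∀ i (g : G i), f g = PushoutI.of i g) :
    ∃ w : CoprodI.Word fun i => G i, PushoutI.Reduced φ w ∧
      PushoutI.ofCoprodI w.prod = f L.prod ∧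
      (L = [] → w = .empty) ∧ (L ≠ [] → w.fstIdx = some i) := by
  induction hL with
  | nil => exact ⟨.empty, by simp [PushoutI.Reduced, CoprodI.Word.empty], by simp, by simp, by simp⟩
  | @cons i j g L hg hg' _ ih =>
    obtain ⟨w, hw, hprod, hnil, hfst⟩ := ih
    have hidx : w.fstIdx ≠ some i := by
      by_cases hL : L = []
      · simp [hnil hL, CoprodI.Word.fstIdx, CoprodI.Word.empty]
      · simp [hfst hL]
    have h1 : (⟨g, hg⟩ : G i) ≠ 1 := fun h => hg' (by
      rw [show g = 1 from congrArg Subtype.val h]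
      exact one_mem _)
    refine ⟨w.cons ⟨g, hg⟩ hidx h1, ?_, ?_, by simp, fun _ => rfl⟩
    · intro l hl
      rcases List.mem_cons.1 hl with rfl | hl
      · rintro ⟨x, hx⟩
        refine hg' ?_
        rw [show g = x from (congrArg Subtype.val hx).symm.trans (hφ i x)]
        exact (Subgroup.mem_iInf.1 x.2) _
      · exact hw l hl
    · rw [CoprodI.Word.prod_cons, map_mul, hprod, PushoutI.ofCoprodI_of, ← hf, List.prod_cons,
        map_mul]

open Monoid in
theorem prod_ne_one {i j : Bool} {L : List A} (hL : Alternates G i j L) (hne : L ≠ [])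
    {φ : ∀ i, (⨅ i, G i : Subgroup A) →* G i} (hφ : ∀ i x, (φ i x : A) = x) (f : A →* PushoutI φ)
    (hf : ∀ i (g : G i), f g = PushoutI.of i g) : L.prod ≠ 1 := by
  intro h
  obtain ⟨w, hw, hprod, -, hfst⟩ := hL.exists_word hφ f hf
  have hempty : w = .empty := hw.eq_empty_of_mem_range
    (fun i x y hxy => Subtype.ext (by rw [← hφ i, hxy, hφ]))
    (by rw [hprod, h, map_one]; exact one_mem _)
  rw [hempty] at hfst
  exact absurd (hfst hne) (by simp [CoprodI.Word.fstIdx, CoprodI.Word.empty])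

end Alternates

end Amalgam

theorem σ_mem_specialSubgroup {v : V} {X : Set V} (hv : v ∈ X) : Γ.σ v ∈ Γ.specialSubgroup X :=
  Subgroup.subset_closure (Set.mem_image_of_mem _ hv)

theorem iSup_specialSubgroup_eq_top {X : Bool → Set V} (hX : ∀ v, ∃ i, v ∈ X i) :
    ⨆ i, Γ.specialSubgroup (X i) = ⊤ := by
  rw [eq_top_iff, ← PresentedGroup.closure_range_of, Subgroup.closure_le]
  rintro _ ⟨v, rfl⟩
  obtain ⟨i, hi⟩ := hX v
  exact Subgroup.mem_iSup_of_mem i (Γ.σ_mem_specialSubgroup hi)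

open Monoid in
/-- If any two vertices joined by an edge lie in a common `X i`, the Artin group maps to the
amalgamated product of the special subgroups of the `X i`, compatibly with their inclusions. -/
theorem exists_hom_pushoutI {X : Bool → Set V}
    (hX : ∀ u v, Γ.m u v ≠ ⊤ → ∃ i, u ∈ X i ∧ v ∈ X i) (hX' : ∀ v, ∃ i, v ∈ X i)
    {φ : ∀ i, (⨅ i, Γ.specialSubgroup (X i) : Subgroup _) →* Γ.specialSubgroup (X i)}
    (hφ : ∀ i x, (φ i x : Γ.ArtinGroup) = x) :
    ∃ f : Γ.ArtinGroup →* PushoutI φ,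
      ∀ i (g : Γ.specialSubgroup (X i)), f g = PushoutI.of i g := by
  choose c hc using hX'
  set F : V → PushoutI φ := fun v => PushoutI.of (c v) ⟨Γ.σ v, Γ.σ_mem_specialSubgroup (hc v)⟩
    with hF
  have key (v : V) (i : Bool) (hi : v ∈ X i) :
      F v = PushoutI.of i ⟨Γ.σ v, Γ.σ_mem_specialSubgroup hi⟩ := by
    rcases eq_or_ne i (c v) with rfl | hne
    · rfl
    have hmem : Γ.σ v ∈ (⨅ i, Γ.specialSubgroup (X i) : Subgroup _) :=
      Subgroup.mem_iInf.2 fun k => Γ.σ_mem_specialSubgroup (by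
        rcases eq_or_ne k i with rfl | hk
        · exact hi
        · rw [Bool.eq_not_of_ne hk, ← Bool.eq_not_of_ne hne.symm]
          exact hc v)
    have h (k : Bool) (hk : v ∈ X k) : (⟨Γ.σ v, Γ.σ_mem_specialSubgroup hk⟩ :
        Γ.specialSubgroup (X k)) = φ k ⟨_, hmem⟩ := Subtype.ext (hφ k ⟨_, hmem⟩).symm
    rw [hF]
    dsimp only
    rw [h _ (hc v), h i hi, PushoutI.of_apply_eq_base, PushoutI.of_apply_eq_base]
  refine ⟨Γ.artinLift F fun u v k huv hk => ?_, ?_⟩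
  · obtain ⟨i, hu, hv⟩ := hX u v (by simp [hk])
    rw [key u i hu, key v i hv, ← map_altProd, ← map_altProd]
    congr 1
    refine Subtype.ext ?_
    rw [← Subgroup.subtype_apply, ← Subgroup.subtype_apply, map_altProd, map_altProd]
    exact Γ.altProd_σ_comm huv hk
  · rintro i ⟨g, hg⟩
    induction hg using Subgroup.closure_induction with
    | mem _ h =>
      obtain ⟨v, hv, rfl⟩ := h
      exact (Γ.artinLift_σ F _ v).trans (key v i hv)
    | one => exact (map_one _).trans (map_one (PushoutI.of (φ := φ) i)).symm
    | mul g h _ _ hg hh =>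
      rw [map_mul, hg, hh, ← map_mul]
      rfl
    | inv g _ hg =>
      rw [map_inv, hg, ← map_inv]
      rfl

theorem center_le_specialSubgroup_compl_singleton {v : V} (hv : ¬ Γ.IsConePoint v) :
    Subgroup.center Γ.ArtinGroup ≤ Γ.specialSubgroup {v}ᶜ := by
  obtain ⟨w, hwv, hm⟩ : ∃ w, w ≠ v ∧ Γ.m v w = ⊤ := by simpa [IsConePoint] using hv
  let X : Bool → Set V := fun i => {bif i then v else w}ᶜ
  have hX (a : V) : ∃ i, a ∈ X i := by
    rcases eq_or_ne a v with rfl | ha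
    · exact ⟨false, hwv.symm⟩
    · exact ⟨true, ha⟩
  have hX' (a b : V) (hab : Γ.m a b ≠ ⊤) : ∃ i, a ∈ X i ∧ b ∈ X i := by
    by_contra! h
    have h1 := h true
    have h2 := h false
    simp only [X, cond_true, cond_false, Set.mem_compl_iff, Set.mem_singleton_iff, not_not] at h1 h2
    by_cases ha : a = v
    · subst ha
      obtain rfl := h2 hwv.symm
      exact hab hm
    · obtain rfl := h1 ha
      have : a = w := by
        by_contra haw
        exact hwv (h2 haw).symm
      subst this
      exact hab (Γ.symm _ _ ▸ hm)
  have hproper (i : Bool) :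
      ∃ b ∈ Γ.specialSubgroup (X i), b ∉ Γ.specialSubgroup (X !i) := by
    cases i
    · exact ⟨Γ.σ v, Γ.σ_mem_specialSubgroup hwv.symm, Γ.σ_notMem_specialSubgroup (by simp [X])⟩
    · exact ⟨Γ.σ w, Γ.σ_mem_specialSubgroup hwv, Γ.σ_notMem_specialSubgroup (by simp [X])⟩
  let φ (i : Bool) : (⨅ i, Γ.specialSubgroup (X i) : Subgroup _) →* Γ.specialSubgroup (X i) :=
    Subgroup.inclusion (iInf_le _ i)
  obtain ⟨f, hf⟩ := Γ.exists_hom_pushoutI (φ := φ) hX' hX fun _ _ => rfl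
  exact fun z hz => Alternates.mem_of_mem_center (Γ.iSup_specialSubgroup_eq_top hX) hproper
    (fun _ _ _ hL hne => hL.prod_ne_one hne (fun _ _ => rfl) f hf) hz true

theorem le_specialSubgroup_compl_of_finite {H : Subgroup Γ.ArtinGroup} {S : Set V}
    (hS : S.Finite) (h : ∀ v ∈ S, H ≤ Γ.specialSubgroup {v}ᶜ) : H ≤ Γ.specialSubgroup Sᶜ := by
  induction S, hS using Set.Finite.induction_on with
  | empty =>
    rw [Set.compl_empty, specialSubgroup, Set.image_univ]
    exact le_top.trans_eq (PresentedGroup.closure_range_of _).symm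
  | insert _ _ ih =>
    rw [Set.insert_eq, Set.compl_union]
    have hle := ih fun v hv => h v (Set.mem_insert_of_mem _ hv)
    exact (le_inf (h _ (Set.mem_insert _ _)) hle).trans (Γ.specialSubgroup_inf_le _ _)

end LabelledGraph

/-- Let `T` be the set of cone points of `Γ`. Then the center of the
Artin group `A_Γ` is contained in the special subgroup `A_T`; in particular every
central element of `A_Γ` lies in, and is central in, `A_T`. -/
theorem center_le_specialSubgroup_conePoints {V : Type*} [Finite V] (Γ : LabelledGraph V) :
    Subgroup.center Γ.ArtinGroup ≤ Γ.specialSubgroup {t | Γ.IsConePoint t} ∧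
    ∀ z ∈ Subgroup.center Γ.ArtinGroup,
      z ∈ Γ.specialSubgroup {t | Γ.IsConePoint t} ∧
      ∀ w ∈ Γ.specialSubgroup {t | Γ.IsConePoint t}, z * w = w * z := by
  have h : Subgroup.center Γ.ArtinGroup ≤ Γ.specialSubgroup {t | Γ.IsConePoint t} := by
    rw [← compl_compl {t | Γ.IsConePoint t}]
    exact Γ.le_specialSubgroup_compl_of_finite (Set.toFinite _)
      fun v hv => Γ.center_le_specialSubgroup_compl_singleton hv
  exact ⟨h, fun z hz => ⟨h hz, fun w _ => (Subgroup.mem_center_iff.1 hz w).symm⟩⟩
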